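/- arXiv:1010.2388 — 8 statements merged into one kernel-verified Lean document; each statement's English description precedes it below -/
import Mathlib

section
/- Let c ∈ ℝ, c ≠ 0, define k(x) = c·tan²x and ψ(x) = −cot x. Then for every x ∈ ℝ with sin x ≠ 0 and cos x ≠ 0, the determining equations ψ''(x) = 2ψ(x)ψ'(x) and k'(x)ψ(x) + 2k(x)ψ'(x) = 0 hold. (This establishes that Q = ∂_t − (cot x)∂_x is a nonclassical symmetry operator of u_t = u_xx + c tan²x · u²(1−u), case 1 of Theorem 2.) -/
/-- Case 1 of Theorem 2: for `k = c tan² x` and `ψ = -cot x`, the determining equations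
`ψ'' = 2ψψ'` and `k'ψ + 2kψ' = 0` hold wherever `sin x ≠ 0` and `cos x ≠ 0`, so
`Q = ∂_t - (cot x)∂_x` is a nonclassical symmetry of `u_t = u_xx + c tan²x · u²(1-u)`. -/
theorem stmt_4 (c : ℝ) (hc : c ≠ 0) (k ψ : ℝ → ℝ)
    (hk : ∀ x, k x = c * Real.tan x ^ 2)
    (hψ : ∀ x, ψ x = -(Real.cos x / Real.sin x)) :
    ∀ x : ℝ, Real.sin x ≠ 0 → Real.cos x ≠ 0 →
      deriv (deriv ψ) x = 2 * ψ x * deriv ψ x ∧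
      deriv k x * ψ x + 2 * k x * deriv ψ x = 0 := by
  have h1 : ∀ y, Real.sin y ≠ 0 → deriv ψ y = 1 / Real.sin y ^ 2 := by
    intro y hy
    rw [funext hψ]
    have h := ((Real.hasDerivAt_cos y).div (Real.hasDerivAt_sin y) hy).neg
    refine HasDerivAt.deriv (h.congr_deriv ?_)
    have := Real.sin_sq_add_cos_sq y
    field_simp
    linarith
  intro x hs hcx
  have h2 : deriv (deriv ψ) x = -2 * Real.cos x / Real.sin x ^ 3 := by
    have he : deriv ψ =ᶠ[nhds x] fun y => 1 / Real.sin y ^ 2 := by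
      filter_upwards [Real.continuous_sin.continuousAt.eventually_ne hs] with y hy
      exact h1 y hy
    rw [he.deriv_eq]
    have h := (hasDerivAt_const x (1:ℝ)).div ((Real.hasDerivAt_sin x).pow 2) (pow_ne_zero 2 hs)
    refine HasDerivAt.deriv (h.congr_deriv ?_)
    simp only [Pi.pow_apply]
    field_simp
    norm_num
    ring
  have h3 : deriv k x = 2 * c * Real.tan x / Real.cos x ^ 2 := by
    rw [funext hk]
    have h := ((Real.hasDerivAt_tan hcx).pow 2).const_mul c
    refine HasDerivAt.deriv (h.congr_deriv ?_)
    norm_num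
    ring
  rw [h2, h3, h1 x hs, hk, hψ, Real.tan_eq_sin_div_cos]
  constructor
  · field_simp
  · field_simp
    ring
end

section
/- Let c ∈ ℝ, c ≠ 0, define k(x) = c·tanh²x and ψ(x) = −coth x (where coth x = cosh x / sinh x). Then for every x ≠ 0, the determining equations ψ''(x) = 2ψ(x)ψ'(x) and k'(x)ψ(x) + 2k(x)ψ'(x) = 0 hold. (This establishes that Q = ∂_t − (coth x)∂_x is a nonclassical symmetry operator of u_t = u_xx + c tanh²x · u²(1−u), case 2 of Theorem 2.) -/
/-- Case 2 of Theorem 2: for `k = c tanh² x` and `ψ = -coth x`, the determining equations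
`ψ'' = 2ψψ'` and `k'ψ + 2kψ' = 0` hold for all `x ≠ 0`, so `Q = ∂_t - (coth x)∂_x`
is a nonclassical symmetry of `u_t = u_xx + c tanh²x · u²(1-u)`. -/
theorem stmt_5 (c : ℝ) (hc : c ≠ 0) (k ψ : ℝ → ℝ)
    (hk : ∀ x, k x = c * Real.tanh x ^ 2)
    (hψ : ∀ x, ψ x = -(Real.cosh x / Real.sinh x)) :
    ∀ x : ℝ, x ≠ 0 →
      deriv (deriv ψ) x = 2 * ψ x * deriv ψ x ∧
      deriv k x * ψ x + 2 * k x * deriv ψ x = 0 := by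
  have hs : ∀ x : ℝ, x ≠ 0 → Real.sinh x ≠ 0 := fun x hx h => hx (Real.sinh_eq_zero.mp h)
  have hψ1 : ∀ x : ℝ, x ≠ 0 → HasDerivAt ψ (1 / Real.sinh x ^ 2) x := by
    intro x hx
    have h := ((Real.hasDerivAt_cosh x).div (Real.hasDerivAt_sinh x) (hs x hx)).neg
    have e : ψ = -(Real.cosh / Real.sinh) := by
      funext y; simp [hψ y]
    rw [e]
    refine h.congr_deriv (Eq.symm ?_)
    have := Real.cosh_sq x
    rw [← neg_div]
    congr 1
    linarith
  intro x hx
  have hsx := hs x hx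
  have hcx : Real.cosh x ≠ 0 := (Real.cosh_pos x).ne'
  have hd : deriv ψ =ᶠ[nhds x] fun y => 1 / Real.sinh y ^ 2 := by
    filter_upwards [isOpen_ne.mem_nhds hx] with y hy
    exact (hψ1 y hy).deriv
  have h2 : HasDerivAt (fun y => 1 / Real.sinh y ^ 2) (-2 * Real.cosh x / Real.sinh x ^ 3) x := by
    have h := (hasDerivAt_const x (1 : ℝ)).fun_div ((Real.hasDerivAt_sinh x).fun_pow 2)
      (pow_ne_zero 2 hsx)
    refine h.congr_deriv (Eq.symm ?_)
    norm_num
    field_simp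
  have hk1 : HasDerivAt k (2 * c * Real.sinh x / Real.cosh x ^ 3) x := by
    have h := (((Real.hasDerivAt_sinh x).fun_div (Real.hasDerivAt_cosh x) hcx).fun_pow 2).const_mul c
    have e : k = fun y => c * (Real.sinh y / Real.cosh y) ^ 2 := by
      funext y; rw [hk y, Real.tanh_eq_sinh_div_cosh]
    rw [e]
    refine h.congr_deriv (Eq.symm ?_)
    have h1 : Real.cosh x * Real.cosh x - Real.sinh x * Real.sinh x = 1 := by
      have := Real.cosh_sq x
      linarith
    rw [h1]
    norm_num
    field_simp
  constructor
  · rw [hd.deriv_eq, h2.deriv, (hψ1 x hx).deriv, hψ x]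
    field_simp
  · rw [hk1.deriv, (hψ1 x hx).deriv, hψ x, hk x, Real.tanh_eq_sinh_div_cosh]
    field_simp
    ring
end

section
/- Let c ∈ ℝ, c ≠ 0, define k(x) = c·coth²x (where coth x = cosh x / sinh x) and ψ(x) = −tanh x. Then for every x ≠ 0, the determining equations ψ''(x) = 2ψ(x)ψ'(x) and k'(x)ψ(x) + 2k(x)ψ'(x) = 0 hold. (This establishes that Q = ∂_t − (tanh x)∂_x is a nonclassical symmetry operator of u_t = u_xx + c coth²x · u²(1−u), case 3 of Theorem 2.) -/
/-- Case 3 of Theorem 2: for `k = c coth² x` and `ψ = -tanh x`, the determining equations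
`ψ'' = 2ψψ'` and `k'ψ + 2kψ' = 0` hold for all `x ≠ 0`, so `Q = ∂_t - (tanh x)∂_x`
is a nonclassical symmetry of `u_t = u_xx + c coth²x · u²(1-u)`. -/
theorem stmt_6 (c : ℝ) (hc : c ≠ 0) (k ψ : ℝ → ℝ)
    (hk : ∀ x, k x = c * (Real.cosh x / Real.sinh x) ^ 2)
    (hψ : ∀ x, ψ x = -Real.tanh x) :
    ∀ x : ℝ, x ≠ 0 →
      deriv (deriv ψ) x = 2 * ψ x * deriv ψ x ∧
      deriv k x * ψ x + 2 * k x * deriv ψ x = 0 := by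
  have hψf : ψ = fun x => -(Real.sinh x / Real.cosh x) := by
    funext x; rw [hψ, Real.tanh_eq_sinh_div_cosh]
  have hkf : k = fun x => c * (Real.cosh x / Real.sinh x) ^ 2 := funext hk
  have hd : deriv ψ = fun x => -(1 / Real.cosh x ^ 2) := by
    funext x
    have hC := (Real.cosh_pos x).ne'
    rw [hψf]
    have h := (((Real.hasDerivAt_sinh x).div (Real.hasDerivAt_cosh x) hC).neg).deriv
    refine h.trans ?_
    have h1 := Real.cosh_sq x
    congr 2
    linear_combination h1
  intro x hx
  have hC := (Real.cosh_pos x).ne'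
  have hS : Real.sinh x ≠ 0 := fun h => hx (Real.sinh_eq_zero.1 h)
  have h1 := Real.cosh_sq x
  have hdd : deriv (deriv ψ) x = 2 * Real.sinh x / Real.cosh x ^ 3 := by
    rw [hd]
    have h := ((((hasDerivAt_const x (1 : ℝ)).div ((Real.hasDerivAt_cosh x).pow 2)
      (pow_ne_zero 2 hC))).neg).deriv
    refine h.trans ?_
    simp only [Pi.pow_apply]
    field_simp
    norm_num
    ring
  have hdk : deriv k x = -2 * c * Real.cosh x / Real.sinh x ^ 3 := by
    rw [hkf]
    have h := ((((Real.hasDerivAt_cosh x).div (Real.hasDerivAt_sinh x) hS).pow 2).const_mul c).deriv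
    refine h.trans ?_
    have h2 : Real.sinh x * Real.sinh x - Real.cosh x * Real.cosh x = -1 := by
      linear_combination -h1
    rw [h2]
    simp only [Pi.div_apply]
    field_simp
    norm_num
    field_simp
  rw [hdd, hdk, hd, hkf, hψf]
  constructor
  · field_simp
  · field_simp
    ring
end

section
/- Define k(x) = 2/x², ξ(x,u) = (3/x)(u − 1), and η(x,u) = −(3/x²)u(u − 1)². Then for all x ≠ 0 and all u ∈ ℝ the four determining equations hold: (i) ξ_uu = 0; (ii) 2ξξ_u − 2ξ_xu + η_uu = 0; (iii) 2ξξ_x − 2ηξ_u − 3kξ_u u³ + 3kξ_u u² + 2η_xu − ξ_xx = 0; (iv) −kη_u u²(1 − u) + 2kξ_x u²(1 − u) + η_xx − 2ξ_xη = −k'(x)ξ u²(1 − u) − 2kηu + 3kηu². (This establishes case 6 of Theorem 2: Q = ∂_t + (3/x)(u−1)∂_x − (3/x²)u(u−1)²∂_u is a nonclassical symmetry of u_t = u_xx + (2/x²)u²(1−u).) -/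
/-- Case 6 of Theorem 2: for `k = 2/x²`, `ξ(x,u) = (3/x)(u-1)` and
`η(x,u) = -(3/x²)u(u-1)²`, the four determining equations hold for all `x ≠ 0` and `u`,
so `Q = ∂_t + (3/x)(u-1)∂_x - (3/x²)u(u-1)²∂_u` is a nonclassical symmetry of
`u_t = u_xx + (2/x²) u²(1-u)`. -/
theorem stmt_9 (k : ℝ → ℝ) (ξ η : ℝ → ℝ → ℝ)
    (hk : ∀ x, k x = 2 / x ^ 2)
    (hξ : ∀ x u, ξ x u = 3 / x * (u - 1))
    (hη : ∀ x u, η x u = -(3 / x ^ 2) * u * (u - 1) ^ 2) :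
    ∀ x : ℝ, x ≠ 0 → ∀ u : ℝ,
      deriv (fun v => deriv (fun w => ξ x w) v) u = 0 ∧
      2 * ξ x u * deriv (fun v => ξ x v) u - 2 * deriv (fun y => deriv (fun v => ξ y v) u) x
        + deriv (fun v => deriv (fun w => η x w) v) u = 0 ∧
      2 * ξ x u * deriv (fun y => ξ y u) x - 2 * η x u * deriv (fun v => ξ x v) u
        - 3 * k x * deriv (fun v => ξ x v) u * u ^ 3
        + 3 * k x * deriv (fun v => ξ x v) u * u ^ 2
        + 2 * deriv (fun y => deriv (fun v => η y v) u) x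
        - deriv (fun y => deriv (fun z => ξ z u) y) x = 0 ∧
      -(k x) * deriv (fun v => η x v) u * u ^ 2 * (1 - u)
        + 2 * k x * deriv (fun y => ξ y u) x * u ^ 2 * (1 - u)
        + deriv (fun y => deriv (fun z => η z u) y) x
        - 2 * deriv (fun y => ξ y u) x * η x u
        = -(deriv k x) * ξ x u * u ^ 2 * (1 - u)
          - 2 * k x * η x u * u + 3 * k x * η x u * u ^ 2 := by
  have P : ∀ (c : ℝ) (m : ℤ), deriv (fun y : ℝ => c * y ^ m) = fun y => (c * m) * y ^ (m - 1) := by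
    intro c m
    funext y
    rw [deriv_const_mul_field, deriv_zpow, mul_assoc]
  have q1 : ∀ y : ℝ, 1 / y = y ^ (-1 : ℤ) := by
    intro y; simp
  have hk' : k = fun y => 2 * y ^ (-2 : ℤ) := by
    funext y; rw [hk, zpow_neg, div_eq_mul_inv]; norm_cast
  have hξx : ∀ u, (fun y => ξ y u) = fun y => (3 * (u - 1)) * y ^ (-1 : ℤ) := by
    intro u; funext y; rw [hξ, zpow_neg, zpow_one]; ring
  have hηx : ∀ u, (fun y => η y u) = fun y => (-3 * u * (u - 1) ^ 2) * y ^ (-2 : ℤ) := by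
    intro u; funext y
    have : y ^ (-2 : ℤ) = (y ^ 2)⁻¹ := by rw [zpow_neg]; norm_cast
    rw [hη, this]; ring
  have hξu : ∀ x u, deriv (fun v => ξ x v) u = 3 * x ^ (-1 : ℤ) := by
    intro x u
    have h : HasDerivAt (fun v : ℝ => 3 / x * (v - 1)) (3 / x * 1) u :=
      ((hasDerivAt_id u).sub_const 1).const_mul _
    simp only [hξ]
    rw [h.deriv, zpow_neg, zpow_one]; ring
  have hηu : ∀ x u, deriv (fun v => η x v) u = (-3 * (3 * u ^ 2 - 4 * u + 1)) * x ^ (-2 : ℤ) := by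
    intro x u
    have h := (((hasDerivAt_id u).const_mul (-(3 / x ^ 2))).mul
      (((hasDerivAt_id u).sub_const 1).pow 2))
    have e : (fun v => η x v) = _ := funext fun v => hη x v
    have : x ^ (-2 : ℤ) = (x ^ 2)⁻¹ := by rw [zpow_neg]; norm_cast
    rw [e]
    refine (HasDerivAt.deriv h).trans ?_
    rw [this]; simp; ring
  have hηuu : ∀ x u, deriv (fun v : ℝ => (-3 * (3 * v ^ 2 - 4 * v + 1)) * x ^ (-2 : ℤ)) u
      = (-3 * (6 * u - 4)) * x ^ (-2 : ℤ) := by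
    intro x u
    have h := (((((hasDerivAt_id u).pow 2).const_mul 3).sub
      ((hasDerivAt_id u).const_mul 4)).add_const 1).const_mul (-3) |>.mul_const (x ^ (-2 : ℤ))
    refine (HasDerivAt.deriv h).trans ?_
    simp; left; ring
  intro x hx u
  have z2 : x ^ (-2 : ℤ) = (x ^ 2)⁻¹ := by rw [zpow_neg]; norm_cast
  have z3 : x ^ (-3 : ℤ) = (x ^ 3)⁻¹ := by rw [zpow_neg]; norm_cast
  have z4 : x ^ (-4 : ℤ) = (x ^ 4)⁻¹ := by rw [zpow_neg]; norm_cast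
  simp only [hξu, hηu, hηuu, hξx, hηx, P]
  rw [hk']
  simp only [P, hξ, hη, deriv_const]
  norm_num [z2, z3, z4]
  refine ⟨?_, ?_, ?_⟩ <;> field_simp <;> ring
end

section
/- Define k(x) = 2/x² and η(x,u) = (u² − 1)/x. Then for all x ≠ 0 and all u ∈ ℝ, the determining equation −η_xx − 2ηη_xu − η²η_uu + kη_u u² − kη_u u³ + k'(x)u³ − k'(x)u² − 2kηu + 3kηu² = 0 holds. (This establishes that Q = ∂_x + (1/x)(u² − 1)∂_u is a nonclassical symmetry of u_t = u_xx + (2/x²)u²(1−u).) -/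
/-- τ = 0 case, example 5: for `k = 2/x²` and `η(x,u) = (u²-1)/x`, the determining
equation holds for all `x ≠ 0` and `u`, so `Q = ∂_x + (1/x)(u²-1)∂_u` is a nonclassical
symmetry of `u_t = u_xx + (2/x²)u²(1-u)`. -/
theorem stmt_16 (k : ℝ → ℝ) (η : ℝ → ℝ → ℝ)
    (hk : ∀ x, k x = 2 / x ^ 2)
    (hη : ∀ x u, η x u = (u ^ 2 - 1) / x) :
    ∀ x : ℝ, x ≠ 0 → ∀ u : ℝ,
      -(deriv (fun y => deriv (fun z => η z u) y) x)
        - 2 * η x u * deriv (fun y => deriv (fun w => η y w) u) x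
        - η x u ^ 2 * deriv (fun v => deriv (fun w => η x w) v) u
        + k x * deriv (fun w => η x w) u * u ^ 2
        - k x * deriv (fun w => η x w) u * u ^ 3
        + deriv k x * u ^ 3 - deriv k x * u ^ 2
        - 2 * k x * η x u * u + 3 * k x * η x u * u ^ 2 = 0 := by
  intro x hx u
  have hkd : deriv k x = -4 / x ^ 3 := by
    have h : HasDerivAt (fun y : ℝ => 2 / y ^ 2) (-4 / x ^ 3) x := by
      have := (hasDerivAt_const x (2 : ℝ)).div (hasDerivAt_pow 2 x) (pow_ne_zero 2 hx)
      refine this.congr_deriv ?_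
      field_simp
      norm_num
      ring
    rw [funext hk]
    exact h.deriv
  have hu : ∀ y v : ℝ, deriv (fun w => η y w) v = 2 * v / y := by
    intro y v
    have h : HasDerivAt (fun w : ℝ => (w ^ 2 - 1) / y) (2 * v / y) v := by
      have := ((hasDerivAt_pow 2 v).sub_const 1).div_const y
      refine this.congr_deriv ?_
      norm_num
    simp only [hη]
    exact h.deriv
  have hinv : ∀ c y : ℝ, deriv (fun z : ℝ => c / z) y = -c / y ^ 2 := by
    intro c y
    simp only [div_eq_mul_inv, deriv_const_mul_field, deriv_inv]
    ring
  have hx1 : ∀ y : ℝ, deriv (fun z => η z u) y = -(u ^ 2 - 1) / y ^ 2 := by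
    intro y
    simp only [hη]
    exact hinv _ y
  have hxx : deriv (fun y : ℝ => -(u ^ 2 - 1) / y ^ 2) x = 2 * (u ^ 2 - 1) / x ^ 3 := by
    have := (hasDerivAt_const x (-(u ^ 2 - 1))).div (hasDerivAt_pow 2 x) (pow_ne_zero 2 hx)
    refine (this.congr_deriv ?_).deriv
    field_simp
    norm_num
    try ring
  have huu : deriv (fun v : ℝ => 2 * v / x) u = 2 / x := by
    have := ((hasDerivAt_id u).const_mul 2).div_const x
    refine (this.congr_deriv ?_).deriv
    norm_num
  simp only [hx1, hu, hxx, huu, hinv, hkd]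
  rw [hη, hk]
  field_simp
  ring
end

section
/- Define k(x) = 1/(2x²) and η(x,u) = u²/(2x). Then for all x ≠ 0 and all u ∈ ℝ, the determining equation −η_xx − 2ηη_xu − η²η_uu + kη_u u² − kη_u u³ + k'(x)u³ − k'(x)u² − 2kηu + 3kηu² = 0 holds. (This establishes that Q = ∂_x + (1/(2x))u²∂_u is a nonclassical symmetry of u_t = u_xx + (1/(2x²))u²(1−u).) -/
/-- τ = 0 case, example 6: for `k = 1/(2x²)` and `η(x,u) = u²/(2x)`, the determining
equation holds for all `x ≠ 0` and `u`, so `Q = ∂_x + (1/(2x))u²∂_u` is a nonclassical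
symmetry of `u_t = u_xx + (1/(2x²))u²(1-u)`. -/
theorem stmt_17 (k : ℝ → ℝ) (η : ℝ → ℝ → ℝ)
    (hk : ∀ x, k x = 1 / (2 * x ^ 2))
    (hη : ∀ x u, η x u = u ^ 2 / (2 * x)) :
    ∀ x : ℝ, x ≠ 0 → ∀ u : ℝ,
      -(deriv (fun y => deriv (fun z => η z u) y) x)
        - 2 * η x u * deriv (fun y => deriv (fun w => η y w) u) x
        - η x u ^ 2 * deriv (fun v => deriv (fun w => η x w) v) u
        + k x * deriv (fun w => η x w) u * u ^ 2
        - k x * deriv (fun w => η x w) u * u ^ 3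
        + deriv k x * u ^ 3 - deriv k x * u ^ 2
        - 2 * k x * η x u * u + 3 * k x * η x u * u ^ 2 = 0 := by
  intro x hx u
  have e1 : (fun y => deriv (fun z => η z u) y) = fun y => -(u ^ 2 / 2) * (y ^ 2)⁻¹ := by
    funext y
    have : (fun z => η z u) = fun z => (u ^ 2 / 2) * z⁻¹ := by
      funext z
      rw [hη, div_mul_eq_div_div, div_eq_mul_inv (u ^ 2 / 2) z]
    rw [this, deriv_const_mul_field, deriv_inv]
    ring
  have hsq : HasDerivAt (fun y : ℝ => (y ^ 2)⁻¹) (-2 / x ^ 3) x := by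
    have h := (hasDerivAt_pow 2 x).inv (pow_ne_zero 2 hx)
    refine HasDerivAt.congr_deriv h ?_
    norm_num
    field_simp
  have hu : ∀ y v : ℝ, deriv (fun w => η y w) v = v * y⁻¹ := by
    intro y v
    have : (fun w => η y w) = fun w => (y⁻¹ / 2) * w ^ 2 := by
      funext w
      rw [hη, div_mul_eq_div_div, div_eq_mul_inv (w ^ 2 / 2) y]
      ring
    rw [this, deriv_const_mul_field, (hasDerivAt_pow 2 v).deriv]
    norm_num
    ring
  have hk' : deriv k x = -1 / x ^ 3 := by
    have : k = fun y => (1 / 2) * (y ^ 2)⁻¹ := by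
      funext y
      rw [hk, div_mul_eq_div_div, div_eq_mul_inv (1 / 2) (y ^ 2)]
    rw [this, deriv_const_mul_field, hsq.deriv]
    ring
  rw [e1, deriv_const_mul_field, hsq.deriv, hk']
  simp only [hu]
  rw [deriv_const_mul_field, deriv_inv, deriv_mul_const_field]
  simp only [deriv_id'', hk, hη]
  field_simp
  ring
end

section
/- Define k(x) = 2·tan²(2x) and η(x,u) = −u²·tan(2x). Then for all x with cos(2x) ≠ 0 and all u ∈ ℝ, the determining equation −η_xx − 2ηη_xu − η²η_uu + kη_u u² − kη_u u³ + k'(x)u³ − k'(x)u² − 2kηu + 3kηu² = 0 holds. (This establishes that Q = ∂_x − u²tan(2x)∂_u is a nonclassical symmetry of u_t = u_xx + 2tan²(2x)·u²(1−u).) -/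
/-- τ = 0 case, example 7: for `k = 2tan²(2x)` and `η(x,u) = -u²tan(2x)`, the
determining equation holds for all `x` with `cos(2x) ≠ 0` and all `u`, so
`Q = ∂_x - u²tan(2x)∂_u` is a nonclassical symmetry of
`u_t = u_xx + 2tan²(2x)u²(1-u)`. -/
theorem stmt_18 (k : ℝ → ℝ) (η : ℝ → ℝ → ℝ)
    (hk : ∀ x, k x = 2 * Real.tan (2 * x) ^ 2)
    (hη : ∀ x u, η x u = -(u ^ 2) * Real.tan (2 * x)) :
    ∀ x : ℝ, Real.cos (2 * x) ≠ 0 → ∀ u : ℝ,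
      -(deriv (fun y => deriv (fun z => η z u) y) x)
        - 2 * η x u * deriv (fun y => deriv (fun w => η y w) u) x
        - η x u ^ 2 * deriv (fun v => deriv (fun w => η x w) v) u
        + k x * deriv (fun w => η x w) u * u ^ 2
        - k x * deriv (fun w => η x w) u * u ^ 3
        + deriv k x * u ^ 3 - deriv k x * u ^ 2
        - 2 * k x * η x u * u + 3 * k x * η x u * u ^ 2 = 0 := by
  intro x hx u
  obtain rfl : k = fun x => 2 * Real.tan (2 * x) ^ 2 := funext hk
  obtain rfl : η = fun x u => -(u ^ 2) * Real.tan (2 * x) := by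
    funext x u; exact hη x u
  have hT : ∀ y : ℝ, Real.cos (2 * y) ≠ 0 →
      HasDerivAt (fun z : ℝ => Real.tan (2 * z)) (2 * (1 + Real.tan (2 * y) ^ 2)) y := by
    intro y hy
    have h1 : HasDerivAt (fun z : ℝ => 2 * z) 2 y := by
      simpa using (hasDerivAt_id y).const_mul (2 : ℝ)
    have h2 := (Real.hasDerivAt_tan hy).comp y h1
    refine h2.congr_deriv ?_
    rw [Real.tan_eq_sin_div_cos]
    field_simp
    linarith [Real.sin_sq_add_cos_sq (2 * y)]
  have hev : ∀ᶠ y in nhds x, Real.cos (2 * y) ≠ 0 := by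
    have hc : ContinuousAt (fun y : ℝ => Real.cos (2 * y)) x := by fun_prop
    exact hc.eventually_ne hx
  have hu : ∀ y v : ℝ, deriv (fun w : ℝ => -(w ^ 2) * Real.tan (2 * y)) v
      = -(2 * v) * Real.tan (2 * y) := by
    intro y v
    have h := ((hasDerivAt_pow 2 v).neg).mul_const (Real.tan (2 * y))
    refine (h.congr_deriv ?_).deriv
    norm_num
  have huu : deriv (fun v : ℝ => -(2 * v) * Real.tan (2 * x)) u = -2 * Real.tan (2 * x) := by
    have h := (((hasDerivAt_id u).const_mul (2 : ℝ)).neg).mul_const (Real.tan (2 * x))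
    refine (h.congr_deriv ?_).deriv
    norm_num
  have hxu : deriv (fun y : ℝ => -(2 * u) * Real.tan (2 * y)) x
      = -(2 * u) * (2 * (1 + Real.tan (2 * x) ^ 2)) := ((hT x hx).const_mul _).deriv
  have hk' : deriv (fun y : ℝ => 2 * Real.tan (2 * y) ^ 2) x
      = 8 * Real.tan (2 * x) * (1 + Real.tan (2 * x) ^ 2) := by
    have h := ((hT x hx).pow 2).const_mul (2 : ℝ)
    refine (h.congr_deriv ?_).deriv
    norm_num
    ring
  have hxx : deriv (fun y : ℝ => deriv (fun z : ℝ => -(u ^ 2) * Real.tan (2 * z)) y) x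
      = -(u ^ 2) * (8 * Real.tan (2 * x) * (1 + Real.tan (2 * x) ^ 2)) := by
    have he : (fun y : ℝ => deriv (fun z : ℝ => -(u ^ 2) * Real.tan (2 * z)) y) =ᶠ[nhds x]
        fun y => -(u ^ 2) * (2 * (1 + Real.tan (2 * y) ^ 2)) := by
      filter_upwards [hev] with y hy
      exact ((hT y hy).const_mul _).deriv
    rw [he.deriv_eq]
    have h := ((((hT x hx).pow 2).const_add 1).const_mul (2 : ℝ)).const_mul (-(u ^ 2))
    refine (h.congr_deriv ?_).deriv
    norm_num
    ring_nf
    try simp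
  simp only [hxx, hu, huu, hxu, hk']
  ring
end

section
/- Define k(x) = 2·tanh²(2x) and η(x,u) = u²·tanh(2x). Then for all x ∈ ℝ and all u ∈ ℝ, the determining equation −η_xx − 2ηη_xu − η²η_uu + kη_u u² − kη_u u³ + k'(x)u³ − k'(x)u² − 2kηu + 3kηu² = 0 holds. (This establishes that Q = ∂_x + u²tanh(2x)∂_u is a nonclassical symmetry of u_t = u_xx + 2tanh²(2x)·u²(1−u).) -/
theorem tanh_two_hasDeriv (x : ℝ) : HasDerivAt (fun y : ℝ => Real.tanh (2 * y))
    (2 * (1 - Real.tanh (2 * x) ^ 2)) x := by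
  have h2 : HasDerivAt (fun y : ℝ => 2 * y) 2 x := by
    simpa using (hasDerivAt_id x).const_mul (2 : ℝ)
  have hc : Real.cosh (2 * x) ≠ 0 := (Real.cosh_pos _).ne'
  have h := (h2.sinh).div (h2.cosh) hc
  have e : (fun y : ℝ => Real.tanh (2 * y))
      = (fun y => Real.sinh (2 * y)) / (fun y => Real.cosh (2 * y)) := by
    funext y
    simp [Real.tanh_eq_sinh_div_cosh]
  rw [e]
  refine h.congr_deriv ?_
  rw [Real.tanh_eq_sinh_div_cosh]
  field_simp

/-- τ = 0 case, example 8: for `k = 2tanh²(2x)` and `η(x,u) = u²tanh(2x)`, the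
determining equation holds for all `x` and `u`, so `Q = ∂_x + u²tanh(2x)∂_u` is a
nonclassical symmetry of `u_t = u_xx + 2tanh²(2x)u²(1-u)`. -/
theorem stmt_19 (k : ℝ → ℝ) (η : ℝ → ℝ → ℝ)
    (hk : ∀ x, k x = 2 * Real.tanh (2 * x) ^ 2)
    (hη : ∀ x u, η x u = u ^ 2 * Real.tanh (2 * x)) :
    ∀ x u : ℝ,
      -(deriv (fun y => deriv (fun z => η z u) y) x)
        - 2 * η x u * deriv (fun y => deriv (fun w => η y w) u) x
        - η x u ^ 2 * deriv (fun v => deriv (fun w => η x w) v) u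
        + k x * deriv (fun w => η x w) u * u ^ 2
        - k x * deriv (fun w => η x w) u * u ^ 3
        + deriv k x * u ^ 3 - deriv k x * u ^ 2
        - 2 * k x * η x u * u + 3 * k x * η x u * u ^ 2 = 0 := by
  intro x u
  have hT := tanh_two_hasDeriv
  obtain rfl : k = fun x => 2 * Real.tanh (2 * x) ^ 2 := funext hk
  obtain rfl : η = fun x u => u ^ 2 * Real.tanh (2 * x) := by
    funext x u
    exact hη x u
  have h1 : ∀ y u : ℝ, deriv (fun z => u ^ 2 * Real.tanh (2 * z)) y
      = u ^ 2 * (2 * (1 - Real.tanh (2 * y) ^ 2)) := fun y u =>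
    ((hT y).const_mul (u ^ 2)).deriv
  have h2 : ∀ y u : ℝ, deriv (fun w => w ^ 2 * Real.tanh (2 * y)) u
      = 2 * u * Real.tanh (2 * y) := fun y u => by
    have := ((hasDerivAt_pow 2 u).mul_const (Real.tanh (2 * y))).deriv
    rw [this]
    norm_num
  have h3 : deriv (fun y => u ^ 2 * (2 * (1 - Real.tanh (2 * y) ^ 2))) x
      = -8 * u ^ 2 * Real.tanh (2 * x) * (1 - Real.tanh (2 * x) ^ 2) := by
    have := (((((hT x).pow 2).const_sub 1).const_mul 2).const_mul (u ^ 2)).deriv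
    refine this.trans ?_
    push_cast
    ring
  have h4 : deriv (fun y => 2 * u * Real.tanh (2 * y)) x
      = 2 * u * (2 * (1 - Real.tanh (2 * x) ^ 2)) :=
    ((hT x).const_mul (2 * u)).deriv
  have h5 : deriv (fun v => 2 * v * Real.tanh (2 * x)) u = 2 * Real.tanh (2 * x) := by
    have := (((hasDerivAt_id u).const_mul 2).mul_const (Real.tanh (2 * x))).deriv
    refine this.trans ?_
    ring
  have h6 : deriv (fun y => 2 * Real.tanh (2 * y) ^ 2) x
      = 8 * Real.tanh (2 * x) * (1 - Real.tanh (2 * x) ^ 2) := by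
    have := (((hT x).pow 2).const_mul 2).deriv
    refine this.trans ?_
    push_cast
    ring
  simp only [h1, h2, h3, h4, h5, h6]
  ring
end
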